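/- In the tracing-attack setup, the sum over i = 1,...,n of the expectations of Z_i satisfies Σᵢ E[Z_i] ≥ d/3 − α². -/

import Mathlib

open MeasureTheory ProbabilityTheory
open scoped NNReal ENNReal

/-- The real value of a random sign (`true ↦ +1`, `false ↦ −1`). -/
def signB (b : Bool) : ℝ := if b then 1 else -1

/-- The distribution on `{−1,+1}` (encoded as `Bool`) with mean `p`. -/
noncomputable def bernSign (p : ℝ) : Measure Bool :=
  (((1 + p) / 2).toNNReal : ℝ≥0) • Measure.dirac true
    + (((1 - p) / 2).toNNReal : ℝ≥0) • Measure.dirac false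

instance (p : ℝ) : IsFiniteMeasure (bernSign p) := by
  unfold bernSign; infer_instance

/-- The product distribution `P_μ` on `{−1,+1}^d` with mean vector `μ`. -/
noncomputable def Pprod {d : ℕ} (μ : Fin d → ℝ) : Measure (Fin d → Bool) :=
  Measure.pi fun j => bernSign (μ j)

instance {d : ℕ} (μ : Fin d → ℝ) : IsFiniteMeasure (Pprod μ) := by
  unfold Pprod; infer_instance

/-- The uniform distribution on `[-1,1] ⊆ ℝ`. -/
noncomputable def uniformIcc : Measure ℝ :=
  ((2 : ℝ≥0))⁻¹ • (volume.restrict (Set.Icc (-1 : ℝ) 1))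

instance : IsProbabilityMeasure uniformIcc := by
  constructor
  simp [uniformIcc, Measure.restrict_apply, Real.volume_Icc]
  norm_num
  simp [ENNReal.smul_def, ENNReal.coe_inv, ENNReal.inv_mul_cancel]

/-- The uniform distribution on the cube `[-1,1]^d`. -/
noncomputable def uniformCube (d : ℕ) : Measure (Fin d → ℝ) :=
  Measure.pi fun _ => uniformIcc

noncomputable def pB (b : Bool) (t : ℝ) : ℝ := (1 + signB b * t) / 2

noncomputable def wX {n d : ℕ} (X : Fin n → Fin d → Bool) (μ : Fin d → ℝ) : ℝ :=
  ∏ i, ∏ j, pB (X i j) (μ j)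

lemma cont_pB (b : Bool) : Continuous (pB b) := by unfold pB; fun_prop

lemma cont_wX {n d : ℕ} (X : Fin n → Fin d → Bool) : Continuous (wX X) := by
  unfold wX
  refine continuous_finsetProd _ fun i _ => continuous_finsetProd _ fun j _ => ?_
  exact (cont_pB _).comp (continuous_apply j)

lemma bern_real {p : ℝ} (hp : p ∈ Set.Icc (-1:ℝ) 1) (b : Bool) :
    (bernSign p).real {b} = pB b p := by
  obtain ⟨h1, h2⟩ := hp
  have e1 : 0 ≤ (1 + p) / 2 := by linarith
  have e2 : 0 ≤ (1 - p) / 2 := by linarith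
  cases b <;> simp [bernSign, pB, signB, measureReal_def, e1, e2] <;> ring_nf

lemma sum_prod2 {n d : ℕ} (f : Fin n → Fin d → Bool → ℝ) :
    ∑ X : Fin n → Fin d → Bool, ∏ i, ∏ j, f i j (X i j) = ∏ i, ∏ j, ∑ b, f i j b := by
  rw [← Fintype.prod_sum (fun i (x : Fin d → Bool) => ∏ j, f i j (x j))]
  refine Finset.prod_congr rfl fun i _ => ?_
  rw [← Fintype.prod_sum (fun j (x : Bool) => f i j x)]

lemma sum_wX {n d : ℕ} (μ : Fin d → ℝ) : ∑ X : Fin n → Fin d → Bool, wX X μ = 1 := by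
  unfold wX
  rw [sum_prod2 (fun i j b => pB b (μ j))]
  refine Finset.prod_eq_one fun i _ => Finset.prod_eq_one fun j _ => ?_
  simp [pB, signB]; ring

lemma prod_mul_single {ι : Type*} [Fintype ι] [DecidableEq ι] (f : ι → ℝ) (i : ι) (g : ι → ℝ) :
    (∏ k, f k) * g i = ∏ k, (f k * if k = i then g k else 1) := by
  rw [Finset.prod_mul_distrib]; simp

lemma sum_wX_sub {n d : ℕ} (μ : Fin d → ℝ) (i : Fin n) (j : Fin d) :
    ∑ X : Fin n → Fin d → Bool, wX X μ * (signB (X i j) - μ j) = 0 := by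
  have : ∀ X : Fin n → Fin d → Bool, wX X μ * (signB (X i j) - μ j) =
      ∏ i', ∏ j', (pB (X i' j') (μ j') *
        if i' = i ∧ j' = j then (signB (X i' j') - μ j') else 1) := by
    intro X
    simp only [Finset.prod_mul_distrib, wX]
    congr 1
    rw [Finset.prod_eq_single i, Finset.prod_eq_single j] <;> simp +contextual
  simp only [this]
  rw [sum_prod2 (fun i' j' b => pB b (μ j') *
        if i' = i ∧ j' = j then (signB b - μ j') else 1)]
  refine Finset.prod_eq_zero (Finset.mem_univ i) (Finset.prod_eq_zero (Finset.mem_univ j) ?_)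
  simp [pB, signB]; ring

lemma ae_uniformIcc : ∀ᵐ t ∂uniformIcc, t ∈ Set.Icc (-1:ℝ) 1 := by
  unfold uniformIcc
  exact Measure.ae_smul_measure (ae_restrict_mem measurableSet_Icc) _

lemma ae_cube (d : ℕ) : ∀ᵐ μ ∂(uniformCube d), ∀ j, μ j ∈ Set.Icc (-1:ℝ) 1 := by
  rw [ae_all_iff]
  intro j
  exact (measurePreserving_eval (fun _ : Fin d => uniformIcc) j).quasiMeasurePreserving.ae
    ae_uniformIcc

instance (d : ℕ) : IsProbabilityMeasure (uniformCube d) := by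
  unfold uniformCube; infer_instance

lemma int_cube {d : ℕ} {f : (Fin d → ℝ) → ℝ} (hf : Continuous f) :
    Integrable f (uniformCube d) := by
  have hc : IsCompact (Set.univ.pi fun _ : Fin d => Set.Icc (-1:ℝ) 1) :=
    isCompact_univ_pi fun _ => isCompact_Icc
  obtain ⟨C, hC⟩ := hc.exists_bound_of_continuousOn hf.continuousOn
  refine Integrable.of_bound hf.aestronglyMeasurable C ?_
  filter_upwards [ae_cube d] with μ hμ
  exact hC μ fun j _ => hμ j

lemma integral_X {n d : ℕ} {μ : Fin d → ℝ} (hμ : ∀ j, μ j ∈ Set.Icc (-1:ℝ) 1)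
    (F : (Fin n → Fin d → Bool) → ℝ) :
    ∫ X, F X ∂(Measure.pi fun _ : Fin n => Pprod μ) = ∑ X, wX X μ * F X := by
  rw [integral_fintype Integrable.of_finite]
  refine Finset.sum_congr rfl fun X _ => ?_
  rw [smul_eq_mul]
  congr 1
  rw [measureReal_def, Measure.pi_singleton, ENNReal.toReal_prod]
  unfold wX
  refine Finset.prod_congr rfl fun i _ => ?_
  rw [Pprod, Measure.pi_singleton, ENNReal.toReal_prod]
  refine Finset.prod_congr rfl fun j _ => ?_
  exact bern_real (hμ j) _

lemma wX_nonneg {n d : ℕ} {μ : Fin d → ℝ} (hμ : ∀ j, μ j ∈ Set.Icc (-1:ℝ) 1)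
    (X : Fin n → Fin d → Bool) : 0 ≤ wX X μ := by
  refine Finset.prod_nonneg fun i _ => Finset.prod_nonneg fun j _ => ?_
  obtain ⟨h1, h2⟩ := hμ j
  unfold pB signB
  split_ifs <;> linarith

lemma integral_unif (f : ℝ → ℝ) : ∫ t, f t ∂uniformIcc = 2⁻¹ * ∫ t in (-1:ℝ)..1, f t := by
  rw [uniformIcc, integral_smul_nnreal_measure, intervalIntegral.integral_of_le (by norm_num),
    integral_Icc_eq_integral_Ioc]
  simp [NNReal.smul_def]

lemma one_dim {n : ℕ} (x : Fin n → Bool) :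
    ∫ t, (∏ i, pB (x i) t) * (∑ i, (signB (x i) - t)) ∂uniformIcc =
    ∫ t, (∏ i, pB (x i) t) * (2 * t) ∂uniformIcc := by
  rw [integral_unif, integral_unif]
  congr 1
  rw [← sub_eq_zero, ← intervalIntegral.integral_sub]
  rotate_left
  · apply Continuous.intervalIntegrable
    have := fun i => cont_pB (x i)
    fun_prop
  · apply Continuous.intervalIntegrable
    have := fun i => cont_pB (x i)
    fun_prop
  have hd : ∀ t : ℝ, HasDerivAt (fun t => (1 - t^2) * ∏ i, pB (x i) t)
      ((∏ i, pB (x i) t) * (∑ i, (signB (x i) - t)) - (∏ i, pB (x i) t) * (2 * t)) t := by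
    intro t
    have h1 : HasDerivAt (fun t : ℝ => 1 - t^2) (-(2*t)) t := by
      simpa using (hasDerivAt_pow 2 t).const_sub 1
    have h2 : ∀ i ∈ Finset.univ, HasDerivAt (fun t => pB (x i) t) (signB (x i) / 2) t := by
      intro i _
      have := (((hasDerivAt_id t).const_mul (signB (x i))).const_add 1).div_const 2
      simpa [pB] using this
    have h3 := h1.mul (HasDerivAt.fun_finsetProd h2)
    refine h3.congr_deriv ?_
    rw [Finset.mul_sum, Finset.mul_sum]
    have : ∀ i, (∏ i, pB (x i) t) * (signB (x i) - t) =
        (1 - t^2) * ((∏ j ∈ Finset.univ.erase i, pB (x j) t) • (signB (x i) / 2)) := by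
      intro i
      rw [← Finset.mul_prod_erase _ _ (Finset.mem_univ i), smul_eq_mul]
      have : pB (x i) t * (signB (x i) - t) = (1 - t^2) * (signB (x i) / 2) := by
        unfold pB signB; split_ifs <;> ring
      linear_combination (∏ j ∈ Finset.univ.erase i, pB (x j) t) * this
    simp only [this]
    ring
  rw [intervalIntegral.integral_eq_sub_of_hasDerivAt (fun t _ => hd t)]
  · norm_num
  · apply Continuous.intervalIntegrable
    have := fun i => cont_pB (x i)
    fun_prop

lemma multi_dim {n d : ℕ} (X : Fin n → Fin d → Bool) (j : Fin d) :
    ∫ μ, wX X μ * (∑ i, (signB (X i j) - μ j)) ∂(uniformCube d) =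
    ∫ μ, wX X μ * (2 * μ j) ∂(uniformCube d) := by
  have h1 : ∀ μ : Fin d → ℝ, wX X μ * (∑ i, (signB (X i j) - μ j)) =
      ∏ k, ((∏ i, pB (X i k) (μ k)) * if k = j then ∑ i, (signB (X i k) - μ k) else 1) := by
    intro μ
    rw [wX, Finset.prod_comm]
    exact prod_mul_single _ j (fun k => ∑ i, (signB (X i k) - μ k))
  have h2 : ∀ μ : Fin d → ℝ, wX X μ * (2 * μ j) =
      ∏ k, ((∏ i, pB (X i k) (μ k)) * if k = j then 2 * μ k else 1) := by
    intro μ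
    rw [wX, Finset.prod_comm]
    exact prod_mul_single _ j (fun k => 2 * μ k)
  simp only [h1, h2]
  unfold uniformCube
  rw [integral_fintype_prod_eq_prod (fun k t => ((∏ i, pB (X i k) t) *
      if k = j then ∑ i, (signB (X i k) - t) else 1)),
    integral_fintype_prod_eq_prod (fun k t => ((∏ i, pB (X i k) t) *
      if k = j then 2 * t else 1))]
  refine Finset.prod_congr rfl fun k _ => ?_
  by_cases hk : k = j
  · simp only [hk, if_true]; exact one_dim _
  · simp only [hk, if_false]

lemma integral_sq {d : ℕ} (j : Fin d) : ∫ μ, (μ j)^2 ∂(uniformCube d) = 1 / 3 := by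
  have h := integral_comp_eval (μ := fun _ : Fin d => uniformIcc) (i := j)
    (f := fun t : ℝ => t ^ 2) (by fun_prop)
  unfold uniformCube
  rw [h, integral_unif, integral_pow]
  norm_num

/-- in the tracing-attack setup (`μ` uniform on `[−1,1]^d`,
`X₁,…,Xₙ` i.i.d. from `P_μ`, `Z_i = ⟨M(X) − μ, X_i − μ⟩`, and
`α² = E[‖M(X) − μ‖₂²]`): `Σᵢ E[Z_i] ≥ d/3 − α²`. -/
theorem tracing_sum_Z_lower_bound (n d : ℕ)
    (M : (Fin n → (Fin d → Bool)) → Measure (Fin d → Set.Icc (-1 : ℝ) 1))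
    (hM : ∀ X, IsProbabilityMeasure (M X))
    (α : ℝ)
    (hα : α ^ 2 = ∫ μ, ∫ X, ∫ y, ∑ j, ((y j : ℝ) - μ j) ^ 2
      ∂(M X) ∂(Measure.pi fun _ : Fin n => Pprod μ) ∂(uniformCube d)) :
    (d : ℝ) / 3 - α ^ 2 ≤
      ∑ i : Fin n, ∫ μ, ∫ X, ∫ y, ∑ j, ((y j : ℝ) - μ j) * (signB (X i j) - μ j)
        ∂(M X) ∂(Measure.pi fun _ : Fin n => Pprod μ) ∂(uniformCube d) := by
  have hcw := fun X : Fin n → Fin d → Bool => cont_wX X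
  set m : (Fin n → Fin d → Bool) → Fin d → ℝ := fun X j => ∫ y, (y j : ℝ) ∂(M X) with hm
  set q : (Fin n → Fin d → Bool) → Fin d → ℝ := fun X j => ∫ y, (y j : ℝ)^2 ∂(M X) with hq
  have hq0 : ∀ X j, 0 ≤ q X j := fun X j => integral_nonneg fun y => sq_nonneg _
  have i1 : ∀ X j, Integrable (fun y : Fin d → Set.Icc (-1:ℝ) 1 => (y j : ℝ)) (M X) := by
    intro X j
    refine Integrable.of_bound (Measurable.aestronglyMeasurable (by measurability)) 1 (Filter.Eventually.of_forall fun y => ?_)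
    rw [Real.norm_eq_abs, abs_le]; exact (y j).2
  have i2 : ∀ X j, Integrable (fun y : Fin d → Set.Icc (-1:ℝ) 1 => (y j : ℝ)^2) (M X) := by
    intro X j
    refine Integrable.of_bound (Measurable.aestronglyMeasurable (by measurability)) 1 (Filter.Eventually.of_forall fun y => ?_)
    rw [Real.norm_eq_abs, abs_pow]
    exact pow_le_one₀ (abs_nonneg _) (abs_le.2 (y j).2)
  have hA : ∀ X (μ : Fin d → ℝ), ∫ y, ∑ j, ((y j : ℝ) - μ j) ^ 2 ∂(M X) =
      ∑ j, (q X j - 2 * μ j * m X j + μ j ^ 2) := by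
    intro X μ
    have e : ∀ (y : Fin d → Set.Icc (-1:ℝ) 1) j, ((y j : ℝ) - μ j) ^ 2 =
      (y j : ℝ)^2 - 2 * μ j * (y j : ℝ) + μ j ^ 2 := fun y j => by ring
    simp only [e]
    rw [integral_finsetSum]
    · refine Finset.sum_congr rfl fun j _ => ?_
      have i3 : Integrable (fun y : Fin d → Set.Icc (-1:ℝ) 1 =>
          (y j : ℝ)^2 - 2 * μ j * (y j : ℝ)) (M X) := (i2 X j).sub ((i1 X j).const_mul _)
      rw [integral_add i3 (integrable_const _),
        integral_sub (i2 X j) ((i1 X j).const_mul _), integral_const_mul]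
      simp [hq, hm]
    · intro j _
      exact ((i2 X j).sub ((i1 X j).const_mul _)).add (integrable_const _)
  have hB : ∀ i X (μ : Fin d → ℝ), ∫ y, ∑ j, ((y j : ℝ) - μ j) * (signB (X i j) - μ j) ∂(M X) =
      ∑ j, (m X j - μ j) * (signB (X i j) - μ j) := by
    intro i X μ
    rw [integral_finsetSum]
    · refine Finset.sum_congr rfl fun j _ => ?_
      rw [integral_mul_const, integral_sub (i1 X j) (integrable_const _)]
      simp [hm]
    · intro j _
      exact ((i1 X j).sub (integrable_const _)).mul_const _
  simp only [hA] at hα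
  simp only [hB]
  -- sum over X
  have hα' : α ^ 2 = ∫ μ, ((∑ X, ∑ j, wX X μ * q X j)
      - (∑ X : Fin n → Fin d → Bool, ∑ j, m X j * (wX X μ * (2 * μ j)))
      + ∑ j, μ j ^ 2) ∂(uniformCube d) := by
    rw [hα]
    refine integral_congr_ae ?_
    filter_upwards [ae_cube d] with μ hμ
    rw [integral_X hμ]
    have : ∑ j, μ j ^ 2 = ∑ X : Fin n → Fin d → Bool, wX X μ * ∑ j, μ j ^ 2 := by
      rw [← Finset.sum_mul, sum_wX, one_mul]
    rw [this, ← Finset.sum_sub_distrib, ← Finset.sum_add_distrib]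
    refine Finset.sum_congr rfl fun X _ => ?_
    rw [Finset.mul_sum, Finset.mul_sum, ← Finset.sum_sub_distrib, ← Finset.sum_add_distrib]
    refine Finset.sum_congr rfl fun j _ => ?_
    ring
  have hR : ∀ i : Fin n, ∫ μ, ∫ X, ∑ j, (m X j - μ j) * (signB (X i j) - μ j)
        ∂(Measure.pi fun _ : Fin n => Pprod μ) ∂(uniformCube d) =
      ∫ μ, ∑ X : Fin n → Fin d → Bool, ∑ j, m X j * (wX X μ * (signB (X i j) - μ j))
        ∂(uniformCube d) := by
    intro i
    refine integral_congr_ae ?_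
    filter_upwards [ae_cube d] with μ hμ
    rw [integral_X hμ, ← sub_eq_zero, ← Finset.sum_sub_distrib]
    have : ∀ X : Fin n → Fin d → Bool, wX X μ * ∑ j, (m X j - μ j) * (signB (X i j) - μ j)
        - ∑ j, m X j * (wX X μ * (signB (X i j) - μ j)) =
        ∑ j, (- μ j) * (wX X μ * (signB (X i j) - μ j)) := by
      intro X
      rw [Finset.mul_sum, ← Finset.sum_sub_distrib]
      refine Finset.sum_congr rfl fun j _ => ?_
      ring
    simp only [this]
    rw [Finset.sum_comm]
    refine Finset.sum_eq_zero fun j _ => ?_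
    rw [← Finset.mul_sum, sum_wX_sub, mul_zero]
  simp only [hR]
  have hS : ∑ i : Fin n, ∫ μ, ∑ X : Fin n → Fin d → Bool, ∑ j,
        m X j * (wX X μ * (signB (X i j) - μ j)) ∂(uniformCube d) =
      ∫ μ, ∑ X : Fin n → Fin d → Bool, ∑ j, m X j * (wX X μ * (2 * μ j)) ∂(uniformCube d) := by
    rw [← integral_finsetSum _ (fun i _ => int_cube (by fun_prop))]
    have : ∀ μ : Fin d → ℝ, ∑ i : Fin n, ∑ X : Fin n → Fin d → Bool, ∑ j,
        m X j * (wX X μ * (signB (X i j) - μ j)) =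
        ∑ X : Fin n → Fin d → Bool, ∑ j, m X j * (wX X μ * ∑ i, (signB (X i j) - μ j)) := by
      intro μ
      rw [Finset.sum_comm]
      refine Finset.sum_congr rfl fun X _ => ?_
      rw [Finset.sum_comm]
      refine Finset.sum_congr rfl fun j _ => ?_
      rw [Finset.mul_sum, Finset.mul_sum]
    simp only [this]
    rw [integral_finsetSum _ (fun i _ => int_cube (by fun_prop)),
      integral_finsetSum _ (fun i _ => int_cube (by fun_prop))]
    refine Finset.sum_congr rfl fun X _ => ?_
    rw [integral_finsetSum _ (fun i _ => int_cube (by fun_prop)),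
      integral_finsetSum _ (fun i _ => int_cube (by fun_prop))]
    refine Finset.sum_congr rfl fun j _ => ?_
    rw [integral_const_mul, integral_const_mul, multi_dim]
  rw [hS, hα', integral_add (int_cube (by fun_prop)) (int_cube (by fun_prop)),
    integral_sub (int_cube (by fun_prop)) (int_cube (by fun_prop)),
    integral_finsetSum (f := fun j (μ : Fin d → ℝ) => μ j ^ 2) _
      (fun i _ => int_cube (by fun_prop))]
  simp only [integral_sq]
  have hpos : 0 ≤ ∫ μ, ∑ X, ∑ j, wX X μ * q X j ∂(uniformCube d) := by
    refine integral_nonneg_of_ae ?_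
    filter_upwards [ae_cube d] with μ hμ
    exact Finset.sum_nonneg fun X _ => Finset.sum_nonneg fun j _ =>
      mul_nonneg (wX_nonneg hμ X) (hq0 X j)
  simp only [Finset.sum_const, Finset.card_univ, Fintype.card_fin, nsmul_eq_mul]
  linarith
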